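/- arXiv:2501.00471 — 6 statements merged into one kernel-verified Lean document; each statement's English description precedes it below -/
import Mathlib

section
/- Let a ∈ ℝⁿ, τ > 0, and let s̄ be an optimal solution of the problem (P_{a,τ}). Then for every index i ∈ {1,…,n}: (i) if aᵢ > 0 then 0 ≤ s̄ᵢ ≤ aᵢ; (ii) if aᵢ < 0 then aᵢ ≤ s̄ᵢ ≤ 0; (iii) if aᵢ = 0 then s̄ᵢ = 0. -/
/-- The objective function of problem (P_{a,τ}):
`h(s) = ‖s − a‖₂ + τ‖s‖₁`. -/
noncomputable def srObj {n : ℕ} (a : Fin n → ℝ) (τ : ℝ) (s : Fin n → ℝ) : ℝ :=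
  Real.sqrt (∑ i, (s i - a i) ^ 2) + τ * ∑ i, |s i|

/-- A minimizer of `srObj a τ` cannot have a coordinate replaced by one at least as close to the
corresponding coordinate of `a` and of smaller absolute value. -/
theorem abs_apply_le_of_srObj_le {n : ℕ} {a : Fin n → ℝ} {τ : ℝ} (hτ : 0 < τ)
    {s : Fin n → ℝ} (hopt : ∀ s', srObj a τ s ≤ srObj a τ s') (i : Fin n) {t : ℝ}
    (ht : (t - a i) ^ 2 ≤ (s i - a i) ^ 2) : |s i| ≤ |t| := by
  by_contra! hlt
  refine absurd (hopt (Function.update s i t)) (not_le.mpr ?_)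
  refine add_lt_add_of_le_of_lt (Real.sqrt_le_sqrt (Finset.sum_le_sum fun j _ => ?_))
    (mul_lt_mul_of_pos_left (Finset.sum_lt_sum (fun j _ => ?_) ⟨i, Finset.mem_univ i, ?_⟩) hτ)
  · rcases eq_or_ne j i with rfl | hj
    · simpa using ht
    · simp [hj]
  · rcases eq_or_ne j i with rfl | hj
    · simpa using hlt.le
    · simp [hj]
  · simpa using hlt

theorem stmt_0 {n : ℕ} (a : Fin n → ℝ) (τ : ℝ) (hτ : 0 < τ)
    (sbar : Fin n → ℝ) (hopt : ∀ s, srObj a τ sbar ≤ srObj a τ s) (i : Fin n) :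
    (0 < a i → 0 ≤ sbar i ∧ sbar i ≤ a i) ∧
    (a i < 0 → a i ≤ sbar i ∧ sbar i ≤ 0) ∧
    (a i = 0 → sbar i = 0) := by
  have h0 := abs_apply_le_of_srObj_le hτ hopt i (t := 0)
  have ha := abs_apply_le_of_srObj_le hτ hopt i (t := a i) (by nlinarith [sq_nonneg (sbar i - a i)])
  have hzero (h : (0 - a i) ^ 2 ≤ (sbar i - a i) ^ 2) : sbar i = 0 := by simpa using h0 h
  refine ⟨fun hi => ⟨?_, ?_⟩, fun hi => ⟨?_, ?_⟩, fun hi => ?_⟩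
  · by_contra! hs
    exact hs.ne (hzero (by nlinarith))
  · exact (le_abs_self _).trans (ha.trans_eq (abs_of_pos hi))
  · rw [abs_of_neg hi] at ha
    linarith [neg_abs_le (sbar i)]
  · by_contra! hs
    exact hs.ne' (hzero (by nlinarith))
  · simpa [hi] using ha
end

section
/- Let a ∈ ℝⁿ satisfy a₁ ≥ a₂ ≥ ⋯ ≥ aₙ ≥ 0 and a ≠ 0, and let τ > 0. Then s̄ = 0 is an optimal solution of the problem (P_{a,τ}) if and only if τ ≥ ‖a‖∞ / ‖a‖₂. -/
/-- The Euclidean norm `‖v‖₂`. -/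
noncomputable def norm2 {n : ℕ} (v : Fin n → ℝ) : ℝ :=
  Real.sqrt (∑ i, (v i) ^ 2)

/-- The sup norm `‖v‖∞ = maxᵢ |vᵢ|`. -/
noncomputable def normInf {n : ℕ} (v : Fin n → ℝ) : ℝ :=
  ⨆ i, |v i|

theorem norm2_pos {n : ℕ} {a : Fin n → ℝ} (ha : a ≠ 0) : 0 < norm2 a := by
  obtain ⟨i, hi⟩ := Function.ne_iff.mp ha
  exact Real.sqrt_pos.mpr
    (Finset.sum_pos' (fun j _ => sq_nonneg (a j)) ⟨i, Finset.mem_univ i, sq_pos_of_ne_zero hi⟩)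

theorem sq_norm2 {n : ℕ} (a : Fin n → ℝ) : norm2 a ^ 2 = ∑ i, a i ^ 2 :=
  Real.sq_sqrt (Finset.sum_nonneg fun i _ => sq_nonneg (a i))

theorem abs_le_normInf {n : ℕ} (a : Fin n → ℝ) (i : Fin n) : |a i| ≤ normInf a :=
  le_ciSup (f := fun j => |a j|) (Set.finite_range _).bddAbove i

theorem srObj_zero {n : ℕ} (a : Fin n → ℝ) (τ : ℝ) : srObj a τ 0 = norm2 a := by
  simp [srObj, norm2]

/-- The objective along the `i`-th coordinate axis. -/
theorem srObj_single {n : ℕ} (a : Fin n → ℝ) (τ : ℝ) (i : Fin n) (t : ℝ) :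
    srObj a τ (Pi.single i t) = √(norm2 a ^ 2 - 2 * t * a i + t ^ 2) + τ * |t| := by
  have hsq : ∑ j, ((Pi.single i t : Fin n → ℝ) j - a j) ^ 2
      = norm2 a ^ 2 - 2 * t * a i + t ^ 2 := by
    have hterm : ∀ j, ((Pi.single i t : Fin n → ℝ) j - a j) ^ 2
        = a j ^ 2 + if j = i then t ^ 2 - 2 * t * a i else 0 := by
      intro j
      by_cases h : j = i
      · subst h
        simp
        ring
      · simp [h]
    rw [Finset.sum_congr rfl fun j _ => hterm j, Finset.sum_add_distrib, sq_norm2]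
    simp
    ring
  have habs : ∑ j, |(Pi.single i t : Fin n → ℝ) j| = |t| := by
    rw [Finset.sum_eq_single i] <;> simp +contextual
  rw [srObj, hsq, habs]

theorem norm2_le_srObj {n : ℕ} {a : Fin n → ℝ} (ha : a ≠ 0) {τ : ℝ}
    (h : normInf a ≤ τ * norm2 a) (s : Fin n → ℝ) : norm2 a ≤ srObj a τ s := by
  have hN := norm2_pos ha
  have hcs : ∑ i, (a i - s i) * a i ≤ √(∑ i, (s i - a i) ^ 2) * norm2 a := by
    simpa only [norm2, sub_sq_comm] using
      Real.sum_mul_le_sqrt_mul_sqrt Finset.univ (fun i => a i - s i) a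
  have hexp : ∑ i, (a i - s i) * a i = norm2 a ^ 2 - ∑ i, s i * a i := by
    rw [sq_norm2, ← Finset.sum_sub_distrib]
    exact Finset.sum_congr rfl fun i _ => by ring
  have hholder : ∑ i, s i * a i ≤ τ * norm2 a * ∑ i, |s i| := by
    rw [Finset.mul_sum]
    refine Finset.sum_le_sum fun i _ => ?_
    calc s i * a i ≤ |a i| * |s i| := by
          rw [← abs_mul, mul_comm]
          exact le_abs_self _
      _ ≤ τ * norm2 a * |s i| := by
          gcongr
          exact (abs_le_normInf a i).trans h
  refine le_of_mul_le_mul_right ?_ hN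
  rw [srObj]
  linarith

theorem le_of_norm2_le_srObj {n : ℕ} {a : Fin n → ℝ} (ha : a ≠ 0) {τ : ℝ} (hτ : 0 < τ)
    (h : ∀ s, norm2 a ≤ srObj a τ s) (i : Fin n) : a i ≤ τ * norm2 a := by
  have hN := norm2_pos ha
  by_contra! hlt
  set t := min (norm2 a / (2 * τ)) (a i - τ * norm2 a)
  have ht : 0 < t := lt_min (by positivity) (sub_pos.mpr hlt)
  have ht₁ : t * (2 * τ) ≤ norm2 a := (le_div_iff₀ (by positivity)).mp (min_le_left _ _)
  have ht₂ : t ≤ a i - τ * norm2 a := min_le_right _ _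
  have hs := h (Pi.single i t)
  rw [srObj_single, abs_of_pos ht] at hs
  have hroot : norm2 a - τ * t ≤ √(norm2 a ^ 2 - 2 * t * a i + t ^ 2) := by linarith
  have hsq : (norm2 a - τ * t) ^ 2 ≤ norm2 a ^ 2 - 2 * t * a i + t ^ 2 :=
    (Real.le_sqrt' (by linarith)).mp hroot
  nlinarith [mul_le_mul_of_nonneg_left ht₂ ht.le, mul_pos ht ht, mul_pos hτ ht]

theorem stmt_3 {n : ℕ} (a : Fin n → ℝ)
    (hsort : ∀ i j : Fin n, i ≤ j → a j ≤ a i) (hnn : ∀ i, 0 ≤ a i) (hne : a ≠ 0)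
    (τ : ℝ) (hτ : 0 < τ) :
    (∀ s, srObj a τ 0 ≤ srObj a τ s) ↔ normInf a / norm2 a ≤ τ := by
  have hN := norm2_pos hne
  rw [div_le_iff₀ hN]
  simp only [srObj_zero]
  refine ⟨fun h => ?_, fun h => norm2_le_srObj hne h⟩
  refine Real.iSup_le (fun i => ?_) (by positivity)
  rw [abs_of_nonneg (hnn i)]
  exact le_of_norm2_le_srObj hne hτ h i
end

section
/- Let a ∈ ℝⁿ satisfy a₁ ≥ a₂ ≥ ⋯ ≥ aₙ ≥ 0 and a ≠ 0, and let τ > 0. Then s̄ = a is an optimal solution of the problem (P_{a,τ}) if and only if 0 < τ ≤ 1/√‖a‖₀. -/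
/-- `‖v‖₀`: the number of nonzero entries of `v`. -/
noncomputable def norm0 {n : ℕ} (v : Fin n → ℝ) : ℕ :=
  (Finset.univ.filter fun i => v i ≠ 0).card

theorem norm0_pos {n : ℕ} {a : Fin n → ℝ} (hne : a ≠ 0) : 0 < norm0 a := by
  obtain ⟨i, hi⟩ := Function.ne_iff.mp hne
  exact Finset.card_pos.mpr ⟨i, by simpa using hi⟩

theorem srObj_self {n : ℕ} (a : Fin n → ℝ) (τ : ℝ) : srObj a τ a = τ * ∑ i, |a i| := by
  simp [srObj]

/-- Moving from `a` to `s` lowers the `ℓ¹` norm by at most `√‖a‖₀` times the distance moved. -/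
theorem sum_abs_sub_sum_abs_le {n : ℕ} (a s : Fin n → ℝ) :
    ∑ i, |a i| - ∑ i, |s i| ≤ √(norm0 a) * √(∑ i, (s i - a i) ^ 2) := by
  set S := Finset.univ.filter fun i => a i ≠ 0 with hS
  have ha : ∑ i ∈ S, |a i| = ∑ i, |a i| :=
    Finset.sum_subset S.subset_univ fun i _ hi => by simpa [hS] using hi
  have hs : ∑ i ∈ S, |s i| ≤ ∑ i, |s i| :=
    Finset.sum_le_sum_of_subset_of_nonneg S.subset_univ fun i _ _ => abs_nonneg _
  have hsq : ∑ i ∈ S, (s i - a i) ^ 2 ≤ ∑ i, (s i - a i) ^ 2 :=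
    Finset.sum_le_sum_of_subset_of_nonneg S.subset_univ fun i _ _ => sq_nonneg _
  calc ∑ i, |a i| - ∑ i, |s i| ≤ ∑ i ∈ S, |s i - a i| := by
        have h : ∑ i ∈ S, |a i| ≤ ∑ i ∈ S, (|s i - a i| + |s i|) :=
          Finset.sum_le_sum fun i _ => by
            linarith [abs_sub_abs_le_abs_sub (a i) (s i), abs_sub_comm (a i) (s i)]
        rw [Finset.sum_add_distrib] at h
        linarith
    _ ≤ √(norm0 a * ∑ i, (s i - a i) ^ 2) := by
        apply Real.le_sqrt_of_sq_le
        calc (∑ i ∈ S, |s i - a i|) ^ 2 ≤ S.card * ∑ i ∈ S, |s i - a i| ^ 2 :=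
              sq_sum_le_card_mul_sum_sq
          _ ≤ norm0 a * ∑ i, (s i - a i) ^ 2 := by
              simp only [sq_abs]
              exact mul_le_mul_of_nonneg_left hsq (Nat.cast_nonneg _)
    _ = √(norm0 a) * √(∑ i, (s i - a i) ^ 2) := Real.sqrt_mul (Nat.cast_nonneg _) _

/-- Lowering every nonzero entry of a nonnegative vector by at most its smallest nonzero entry. -/
theorem srObj_sub_indicator {n : ℕ} {a : Fin n → ℝ} (hnn : ∀ i, 0 ≤ a i) (τ : ℝ) {m : ℝ}
    (hm : 0 ≤ m) (hle : ∀ i, a i ≠ 0 → m ≤ a i) :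
    srObj a τ (fun i => a i - if a i ≠ 0 then m else 0) =
      √(norm0 a) * m + τ * (∑ i, |a i| - norm0 a * m) := by
  have hsq : ∀ i, (a i - (if a i ≠ 0 then m else 0) - a i) ^ 2 =
      if a i ≠ 0 then m ^ 2 else 0 := fun i => by split_ifs <;> ring
  have habs : ∀ i, |a i - if a i ≠ 0 then m else 0| = |a i| - if a i ≠ 0 then m else 0 := by
    intro i
    rw [abs_of_nonneg (hnn i), abs_of_nonneg]
    split_ifs with h
    · linarith [hle i h]
    · linarith [hnn i]
  have hcard (c : ℝ) : ∑ i, (if a i ≠ 0 then c else 0) = norm0 a * c := by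
    rw [← Finset.sum_filter, Finset.sum_const, nsmul_eq_mul, norm0]
  simp only [srObj, hsq, habs, Finset.sum_sub_distrib, hcard]
  rw [Real.sqrt_mul (Nat.cast_nonneg _), Real.sqrt_sq hm]

theorem stmt_4 {n : ℕ} (a : Fin n → ℝ)
    (hsort : ∀ i j : Fin n, i ≤ j → a j ≤ a i) (hnn : ∀ i, 0 ≤ a i) (hne : a ≠ 0)
    (τ : ℝ) (hτ : 0 < τ) :
    (∀ s, srObj a τ a ≤ srObj a τ s) ↔ (0 < τ ∧ τ ≤ 1 / Real.sqrt (norm0 a)) := by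
  have hk : 0 < √(norm0 a : ℝ) := Real.sqrt_pos.mpr (Nat.cast_pos.mpr (norm0_pos hne))
  rw [le_div_iff₀ hk, srObj_self]
  constructor
  · intro h
    refine ⟨hτ, ?_⟩
    obtain ⟨j, hj, hmin⟩ := Finset.exists_min_image _ a (Finset.card_pos.mp (norm0_pos hne))
    have hm : 0 < a j := (hnn j).lt_of_ne' (Finset.mem_filter.mp hj).2
    have hs := h fun i => a i - if a i ≠ 0 then a j else 0
    rw [srObj_sub_indicator hnn τ hm.le fun i hi => hmin i (by simpa using hi)] at hs
    have hsq : √(norm0 a : ℝ) * √(norm0 a : ℝ) = norm0 a :=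
      Real.mul_self_sqrt (Nat.cast_nonneg _)
    refine le_of_mul_le_mul_right ?_ (mul_pos hk hm)
    calc τ * √(norm0 a) * (√(norm0 a) * a j) = τ * (norm0 a * a j) := by
          linear_combination τ * a j * hsq
      _ ≤ 1 * (√(norm0 a) * a j) := by linarith
  · rintro ⟨-, hle⟩ s
    have h₁ := mul_le_mul_of_nonneg_left (sum_abs_sub_sum_abs_le a s) hτ.le
    have h₂ := mul_le_mul_of_nonneg_right hle (Real.sqrt_nonneg (∑ i, (s i - a i) ^ 2))
    rw [srObj]
    linarith
end

section
/- Let a ∈ ℝⁿ satisfy a₁ ≥ a₂ ≥ ⋯ ≥ aₙ ≥ 0 and a ≠ 0, and suppose τ ∈ (1/√‖a‖₀, ‖a‖∞/‖a‖₂). Let k̄ be the largest integer strictly less than 1/τ². Then 1 ≤ k̄ ≤ ‖a‖₀ − 1 ≤ n − 1, and there exists a unique k ∈ {1,…,k̄} such that a_{k+1} ≤ t_k < a_k, where t_k := √((a_{k+1}² + ⋯ + aₙ²)/(1/τ² − k)). Moreover, the vector s̄ := max(a − t_k·1ₙ, 0) = (a₁ − t_k, …, a_k − t_k, 0, …, 0)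 is an optimal solution of the problem (P_{a,τ}). -/
/-- The vector `a` extended to `ℕ` by zero; `aext a j` is the (1-based) `(j+1)`-th entry. -/
noncomputable def aext {n : ℕ} (a : Fin n → ℝ) (j : ℕ) : ℝ :=
  if h : j < n then a ⟨j, h⟩ else 0

/-- Tail sum of squares `a_{k+1}² + ⋯ + aₙ²` (1-based indexing). -/
noncomputable def tailSq {n : ℕ} (a : Fin n → ℝ) (k : ℕ) : ℝ :=
  ∑ i : Fin n, if k ≤ (i : ℕ) then (a i) ^ 2 else 0

/-- `t_k = √((a_{k+1}² + ⋯ + aₙ²)/(1/τ² − k))`. -/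
noncomputable def tK {n : ℕ} (τ : ℝ) (a : Fin n → ℝ) (k : ℕ) : ℝ :=
  Real.sqrt (tailSq a k / (1 / τ ^ 2 - k))

lemma aext_of_lt {n : ℕ} (a : Fin n → ℝ) (i : Fin n) : aext a i = a i := by
  simp [aext]

lemma aext_nonneg {n : ℕ} {a : Fin n → ℝ} (hnn : ∀ i, 0 ≤ a i) (j : ℕ) : 0 ≤ aext a j := by
  unfold aext
  split_ifs with h
  · exact hnn _
  · exact le_rfl

lemma aext_antitone {n : ℕ} {a : Fin n → ℝ} (hsort : ∀ i j : Fin n, i ≤ j → a j ≤ a i)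
    (hnn : ∀ i, 0 ≤ a i) : Antitone (aext a) := by
  intro i j hij
  by_cases hj : j < n
  · have hi : i < n := hij.trans_lt hj
    simpa [aext, hi, hj] using hsort ⟨i, hi⟩ ⟨j, hj⟩ hij
  · have hj' : aext a j = 0 := by simp [aext, hj]
    rw [hj']
    exact aext_nonneg hnn i

lemma aext_pos_of_lt_norm0 {n : ℕ} {a : Fin n → ℝ}
    (hsort : ∀ i j : Fin n, i ≤ j → a j ≤ a i) (hnn : ∀ i, 0 ≤ a i) {k : ℕ}
    (hk : k < norm0 a) : 0 < aext a k := by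
  by_contra! h
  have hsub : (Finset.univ.filter fun i => a i ≠ 0) ⊆
      Finset.univ.filter fun i : Fin n => (i : ℕ) < k := by
    intro i hi
    simp only [Finset.mem_filter, Finset.mem_univ, true_and] at hi ⊢
    by_contra! hki
    have := aext_antitone hsort hnn hki
    rw [aext_of_lt] at this
    exact hi (le_antisymm (this.trans h) (hnn i))
  have hcard := Finset.card_le_card hsub
  rw [Fin.card_filter_val_lt] at hcard
  unfold norm0 at hk
  have := min_le_right n k
  omega

lemma norm0_le {n : ℕ} (a : Fin n → ℝ) : norm0 a ≤ n := by
  simpa [norm0] using Finset.card_filter_le (Finset.univ : Finset (Fin n)) (fun i => a i ≠ 0)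

lemma tailSq_nonneg {n : ℕ} (a : Fin n → ℝ) (k : ℕ) : 0 ≤ tailSq a k :=
  Finset.sum_nonneg fun i _ => by split_ifs <;> positivity

lemma tailSq_zero {n : ℕ} (a : Fin n → ℝ) : tailSq a 0 = ∑ i, a i ^ 2 := by
  simp [tailSq]

lemma tailSq_eq_add {n : ℕ} (a : Fin n → ℝ) (k : ℕ) :
    tailSq a k = aext a k ^ 2 + tailSq a (k + 1) := by
  have hsingle : ∑ i : Fin n, (if (i : ℕ) = k then a i ^ 2 else 0) = aext a k ^ 2 := by
    by_cases hk : k < n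
    · rw [Finset.sum_eq_single ⟨k, hk⟩]
      · simp [aext, hk]
      · intro i _ hi
        rw [if_neg fun h => hi (Fin.ext h)]
      · simp
    · rw [Finset.sum_eq_zero]
      · simp [aext, hk]
      · intro i _
        rw [if_neg (by have := i.isLt; omega)]
  rw [← hsingle]
  unfold tailSq
  rw [← Finset.sum_add_distrib]
  refine Finset.sum_congr rfl fun i _ => ?_
  rcases lt_trichotomy (i : ℕ) k with h | h | h
  · rw [if_neg (by omega), if_neg (by omega), if_neg (by omega), add_zero]
  · rw [if_pos (by omega), if_pos h, if_neg (by omega), add_zero]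
  · rw [if_pos (by omega), if_neg (by omega), if_pos (by omega), zero_add]

/-- The gap `T_k - (w - k) a_{k+1}²`, whose sign decides both inequalities bracketing `t_k`. -/
noncomputable def tailGap {n : ℕ} (a : Fin n → ℝ) (w : ℝ) (k : ℕ) : ℝ :=
  tailSq a k - (w - k) * aext a k ^ 2

lemma tailGap_eq_succ {n : ℕ} (a : Fin n → ℝ) (w : ℝ) (k : ℕ) :
    tailGap a w k = tailSq a (k + 1) - (w - (k + 1 : ℕ)) * aext a k ^ 2 := by
  rw [tailGap, tailSq_eq_add]
  push_cast
  ring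

lemma tailGap_le_succ {n : ℕ} {a : Fin n → ℝ} (hsort : ∀ i j : Fin n, i ≤ j → a j ≤ a i)
    (hnn : ∀ i, 0 ≤ a i) {w : ℝ} {k : ℕ} (hk : ((k + 1 : ℕ) : ℝ) ≤ w) :
    tailGap a w k ≤ tailGap a w (k + 1) := by
  rw [tailGap_eq_succ, tailGap]
  have hsq : aext a (k + 1) ^ 2 ≤ aext a k ^ 2 :=
    pow_le_pow_left₀ (aext_nonneg hnn _) (aext_antitone hsort hnn k.le_succ) 2
  have := mul_le_mul_of_nonneg_left hsq (sub_nonneg.2 hk)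
  linarith

lemma tailGap_mono {n : ℕ} {a : Fin n → ℝ} (hsort : ∀ i j : Fin n, i ≤ j → a j ≤ a i)
    (hnn : ∀ i, 0 ≤ a i) {w : ℝ} {k l : ℕ} (hkl : k ≤ l) (hl : (l : ℝ) ≤ w) :
    tailGap a w k ≤ tailGap a w l := by
  induction l, hkl using Nat.le_induction with
  | base => exact le_rfl
  | succ l _ ih =>
    refine (ih ?_).trans (tailGap_le_succ hsort hnn hl)
    push_cast at hl
    linarith

lemma aext_le_tK_iff {n : ℕ} {a : Fin n → ℝ} (hnn : ∀ i, 0 ≤ a i) {τ : ℝ} {k : ℕ}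
    (hk : (k : ℝ) < 1 / τ ^ 2) :
    aext a k ≤ tK τ a k ↔ 0 ≤ tailGap a (1 / τ ^ 2) k := by
  have hpos : 0 < 1 / τ ^ 2 - k := sub_pos.2 hk
  rw [tK, Real.le_sqrt (aext_nonneg hnn k), le_div_iff₀ hpos, tailGap, sub_nonneg, mul_comm]
  exact div_nonneg (tailSq_nonneg a k) hpos.le

lemma tK_succ_lt_aext_iff {n : ℕ} {a : Fin n → ℝ} (hnn : ∀ i, 0 ≤ a i) {τ : ℝ} {k : ℕ}
    (hk : ((k + 1 : ℕ) : ℝ) < 1 / τ ^ 2) :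
    tK τ a (k + 1) < aext a k ↔ tailGap a (1 / τ ^ 2) k < 0 := by
  have hpos : 0 < 1 / τ ^ 2 - (k + 1 : ℕ) := sub_pos.2 hk
  rw [tK, Real.sqrt_lt (div_nonneg (tailSq_nonneg _ _) hpos.le) (aext_nonneg hnn k),
    div_lt_iff₀ hpos, tailGap_eq_succ, sub_neg, mul_comm]

/-- If `t > 0` and the truncation of a nonnegative `a` at level `t` has squared Euclidean norm
`t² / τ²`, then soft thresholding at level `t` minimizes the objective. -/
lemma srObj_softThreshold_le {n : ℕ} {a : Fin n → ℝ} (hnn : ∀ i, 0 ≤ a i) {τ t : ℝ}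
    (hτ : 0 < τ) (ht : 0 < t) (hsum : ∑ i, min (a i) t ^ 2 = (t / τ) ^ 2) (s : Fin n → ℝ) :
    srObj a τ (fun i => max (a i - t) 0) ≤ srObj a τ s := by
  have hmm : ∀ i, max (a i - t) 0 = a i - min (a i) t := by
    intro i
    rcases le_total (a i) t with h | h
    · rw [max_eq_right (by linarith), min_eq_left h, sub_self]
    · rw [max_eq_left (by linarith), min_eq_right h]
  have hval : srObj a τ (fun i => max (a i - t) 0) =
      t / τ + τ * ∑ i, max (a i - t) 0 := by
    unfold srObj
    congr 1
    · have : ∀ i, (max (a i - t) 0 - a i) ^ 2 = min (a i) t ^ 2 := by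
        intro i
        rw [hmm]
        ring
      simp only [this]
      rw [hsum, Real.sqrt_sq (by positivity)]
    · simp only [abs_of_nonneg (le_max_right (_ : ℝ) 0)]
  have hcs : ∑ i, min (a i) t * (a i - s i) ≤ t / τ * √(∑ i, (s i - a i) ^ 2) := by
    have h := Real.sum_mul_le_sqrt_mul_sqrt Finset.univ (fun i => min (a i) t)
      (fun i => a i - s i)
    rw [hsum, Real.sqrt_sq (by positivity)] at h
    simpa only [sub_sq_comm] using h
  have hmin : ∑ i, min (a i) t * (a i - s i) ≥
      (t / τ) ^ 2 + t * ∑ i, max (a i - t) 0 - t * ∑ i, |s i| := by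
    rw [← hsum, Finset.mul_sum, Finset.mul_sum, ← Finset.sum_add_distrib,
      ← Finset.sum_sub_distrib]
    refine Finset.sum_le_sum fun i _ => ?_
    have hmt : min (a i) t * max (a i - t) 0 = t * max (a i - t) 0 := by
      rcases le_total (a i) t with h | h
      · rw [max_eq_right (by linarith), mul_zero, mul_zero]
      · rw [min_eq_right h]
    have hms : min (a i) t * s i ≤ t * |s i| :=
      (mul_le_mul_of_nonneg_left (le_abs_self _) (le_min (hnn i) ht.le)).trans
        (mul_le_mul_of_nonneg_right (min_le_right _ _) (abs_nonneg _))
    have hexp : min (a i) t * a i = min (a i) t ^ 2 + t * max (a i - t) 0 := by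
      rw [← hmt, hmm]; ring
    linarith [mul_sub (min (a i) t) (a i) (s i)]
  rw [hval, srObj]
  have hdiv : 0 < t / τ := by positivity
  refine le_of_mul_le_mul_left ?_ hdiv
  have hcancel : ∀ x, t / τ * (τ * x) = t * x := fun x => by field_simp
  rw [mul_add, mul_add, hcancel, hcancel]
  linarith [sq (t / τ)]

lemma sum_min_sq_eq {n : ℕ} {a : Fin n → ℝ} {k : ℕ} {t : ℝ} (hkn : k ≤ n)
    (hlt : ∀ i : Fin n, (i : ℕ) < k → t ≤ a i) (hge : ∀ i : Fin n, k ≤ (i : ℕ) → a i ≤ t) :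
    ∑ i, min (a i) t ^ 2 = k * t ^ 2 + tailSq a k := by
  have hhead : ∑ i : Fin n, (if (i : ℕ) < k then t ^ 2 else 0) = k * t ^ 2 := by
    rw [← Finset.sum_filter, Finset.sum_const, Fin.card_filter_val_lt, min_eq_right hkn,
      nsmul_eq_mul]
  rw [← hhead, tailSq, ← Finset.sum_add_distrib]
  refine Finset.sum_congr rfl fun i _ => ?_
  by_cases h : (i : ℕ) < k
  · rw [if_pos h, if_neg (by omega), min_eq_right (hlt i h), add_zero]
  · rw [if_neg h, if_pos (by omega), min_eq_left (hge i (by omega)), zero_add]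

lemma tau_pos_and_bounds {n : ℕ} {a : Fin n → ℝ}
    (hsort : ∀ i j : Fin n, i ≤ j → a j ≤ a i) (hnn : ∀ i, 0 ≤ a i) (hne : a ≠ 0)
    {τ : ℝ} (hτ₁ : 1 / √(norm0 a) < τ) (hτ₂ : τ < normInf a / norm2 a) :
    0 < τ ∧ 1 / τ ^ 2 < norm0 a ∧ tailGap a (1 / τ ^ 2) 0 < 0 := by
  obtain ⟨i₀, hi₀⟩ := Function.ne_iff.1 hne
  have hnorm0 : 0 < norm0 a := Finset.card_pos.2 ⟨i₀, by simpa using hi₀⟩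
  have hnorm0' : (0 : ℝ) < norm0 a := by exact_mod_cast hnorm0
  have hτ : 0 < τ := lt_of_le_of_lt (by positivity) hτ₁
  have hsum : 0 < ∑ i, a i ^ 2 :=
    Finset.sum_pos' (fun i _ => sq_nonneg _)
      ⟨i₀, Finset.mem_univ _, by have : a i₀ ≠ 0 := hi₀; positivity⟩
  have hnorm2 : 0 < norm2 a := Real.sqrt_pos.2 hsum
  have hsup : normInf a ≤ aext a 0 := by
    have : Nonempty (Fin n) := ⟨i₀⟩
    refine ciSup_le fun i => ?_
    rw [abs_of_nonneg (hnn i), ← aext_of_lt a i]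
    exact aext_antitone hsort hnn (Nat.zero_le _)
  refine ⟨hτ, ?_, ?_⟩
  · rw [div_lt_iff₀ (Real.sqrt_pos.2 hnorm0')] at hτ₁
    have h := pow_lt_pow_left₀ hτ₁ zero_le_one two_ne_zero
    rw [mul_pow, Real.sq_sqrt hnorm0'.le, one_pow] at h
    rw [div_lt_iff₀ (by positivity), mul_comm]
    exact h
  · rw [lt_div_iff₀ hnorm2] at hτ₂
    have h := pow_lt_pow_left₀ (hτ₂.trans_le hsup) (by positivity) two_ne_zero
    rw [mul_pow, norm2, Real.sq_sqrt hsum.le] at h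
    rw [tailGap, tailSq_zero, Nat.cast_zero, sub_zero, sub_neg, one_div_mul_eq_div,
      lt_div_iff₀ (by positivity), mul_comm]
    exact h

theorem stmt_5 {n : ℕ} (a : Fin n → ℝ)
    (hsort : ∀ i j : Fin n, i ≤ j → a j ≤ a i) (hnn : ∀ i, 0 ≤ a i) (hne : a ≠ 0)
    (τ : ℝ) (hτ₁ : 1 / Real.sqrt (norm0 a) < τ) (hτ₂ : τ < normInf a / norm2 a)
    (kbar : ℕ) (hkbar : (kbar : ℝ) < 1 / τ ^ 2 ∧ ∀ m : ℕ, (m : ℝ) < 1 / τ ^ 2 → m ≤ kbar) :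
    (1 ≤ kbar ∧ kbar ≤ norm0 a - 1 ∧ norm0 a - 1 ≤ n - 1) ∧
    (∃! k : ℕ, (1 ≤ k ∧ k ≤ kbar) ∧ aext a k ≤ tK τ a k ∧ tK τ a k < aext a (k - 1)) ∧
    (∀ k : ℕ, (1 ≤ k ∧ k ≤ kbar) → aext a k ≤ tK τ a k → tK τ a k < aext a (k - 1) →
      ∀ s, srObj a τ (fun i => max (a i - tK τ a k) 0) ≤ srObj a τ s) := by
  obtain ⟨hτ, hw, hgap0⟩ := tau_pos_and_bounds hsort hnn hne hτ₁ hτ₂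
  obtain ⟨hkw, hkmax⟩ := hkbar
  have hlt : ∀ {k : ℕ}, k ≤ kbar → (k : ℝ) < 1 / τ ^ 2 := fun hk =>
    lt_of_le_of_lt (Nat.cast_le.2 hk) hkw
  have hk0 : kbar < norm0 a := by exact_mod_cast hkw.trans hw
  have hn := norm0_le a
  have hlast : 0 ≤ tailGap a (1 / τ ^ 2) kbar := by
    have hle : 1 / τ ^ 2 ≤ (kbar + 1 : ℕ) := by
      by_contra! h
      have := hkmax _ h
      omega
    rw [tailGap_eq_succ]
    have := mul_nonneg (sub_nonneg.2 hle) (sq_nonneg (aext a kbar))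
    linarith [tailSq_nonneg a (kbar + 1)]
  have hk1 : 1 ≤ kbar := by
    by_contra! h
    obtain rfl : kbar = 0 := by omega
    exact absurd hlast hgap0.not_ge
  have hiff : ∀ k, 1 ≤ k → k ≤ kbar →
      ((aext a k ≤ tK τ a k ∧ tK τ a k < aext a (k - 1)) ↔
        0 ≤ tailGap a (1 / τ ^ 2) k ∧ tailGap a (1 / τ ^ 2) (k - 1) < 0) := by
    intro k h1 h2
    obtain ⟨j, rfl⟩ := Nat.exists_eq_succ_of_ne_zero (by omega : k ≠ 0)
    exact and_congr (aext_le_tK_iff hnn (hlt h2)) (tK_succ_lt_aext_iff hnn (hlt h2))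
  refine ⟨⟨hk1, by omega, by omega⟩, ?_, ?_⟩
  · classical
    have hex : ∃ k, 0 ≤ tailGap a (1 / τ ^ 2) k := ⟨kbar, hlast⟩
    have hspec := Nat.find_spec hex
    have hle : Nat.find hex ≤ kbar := Nat.find_min' hex hlast
    have hpos : 1 ≤ Nat.find hex := by
      by_contra! h
      rw [Nat.lt_one_iff.1 h] at hspec
      exact absurd hspec hgap0.not_ge
    refine ⟨Nat.find hex, ⟨⟨hpos, hle⟩, (hiff _ hpos hle).2
      ⟨hspec, not_le.1 (Nat.find_min hex (by omega))⟩⟩, ?_⟩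
    rintro k ⟨⟨h1, h2⟩, h3⟩
    obtain ⟨h4, h5⟩ := (hiff k h1 h2).1 h3
    refine le_antisymm ?_ (Nat.find_min' hex h4)
    by_contra! h
    have := tailGap_mono hsort hnn (by omega : Nat.find hex ≤ k - 1)
      (hlt (by omega : k - 1 ≤ kbar)).le
    linarith
  · rintro k ⟨h1, h2⟩ h3 h4
    have hpos : 0 < aext a k := aext_pos_of_lt_norm0 hsort hnn (by omega)
    refine srObj_softThreshold_le hnn hτ (hpos.trans_le h3) ?_
    rw [sum_min_sq_eq (k := k) (by omega)]
    · have hden : 0 < 1 / τ ^ 2 - k := sub_pos.2 (hlt h2)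
      have htail : tailSq a k = (1 / τ ^ 2 - k) * tK τ a k ^ 2 := by
        rw [tK, Real.sq_sqrt (div_nonneg (tailSq_nonneg _ _) hden.le),
          mul_div_cancel₀ _ hden.ne']
      rw [htail]
      ring
    · intro i hi
      rw [← aext_of_lt a i]
      exact h4.le.trans (aext_antitone hsort hnn (by omega))
    · intro i hi
      rw [← aext_of_lt a i]
      exact (aext_antitone hsort hnn hi).trans h3
end

section
/- Let a ∈ ℝⁿ satisfy a₁ ≥ a₂ ≥ ⋯ ≥ aₙ ≥ 0 and a ≠ 0, and let τ = 1/√‖a‖₀. Then for every ε with 0 ≤ ε ≤ min{aᵢ : aᵢ > 0}, the vector a^ε whose i-th entry equals aᵢ − ε when aᵢ > 0 and equals 0 when aᵢ = 0 is an optimal solution of the problem (P_{a,τ}). -/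
theorem sum_le_sqrt_card_mul_sqrt_sum_sq {ι : Type*} (S : Finset ι) (f : ι → ℝ) :
    ∑ i ∈ S, f i ≤ √(S.card : ℝ) * √(∑ i ∈ S, f i ^ 2) := by
  rw [← Real.sqrt_mul (Nat.cast_nonneg _)]
  exact Real.le_sqrt_of_sq_le sq_sum_le_card_mul_sum_sq

/-- With `τ = 1/√‖a‖₀`, the value `τ ∑ aᵢ` is a lower bound for the objective. -/
theorem mul_sum_le_srObj {n : ℕ} {a : Fin n → ℝ} (hne : a ≠ 0) (s : Fin n → ℝ) :
    1 / √(norm0 a : ℝ) * ∑ i, a i ≤ srObj a (1 / √(norm0 a : ℝ)) s := by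
  have hk : 0 < √(norm0 a : ℝ) := Real.sqrt_pos.mpr (by exact_mod_cast norm0_pos hne)
  set S := Finset.univ.filter fun i => a i ≠ 0
  have hsum : ∑ i, a i = ∑ i ∈ S, (a i - s i) + ∑ i ∈ S, s i := by
    rw [← Finset.sum_add_distrib]
    simp [S, Finset.sum_filter_ne_zero]
  have hdiff : ∑ i ∈ S, (a i - s i) ≤ √(norm0 a : ℝ) * √(∑ i, (s i - a i) ^ 2) := by
    refine (sum_le_sqrt_card_mul_sqrt_sum_sq S _).trans ?_
    refine mul_le_mul_of_nonneg_left (Real.sqrt_le_sqrt ?_) hk.le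
    simp only [sub_sq_comm (a _)]
    exact Finset.sum_le_univ_sum_of_nonneg fun i => sq_nonneg _
  have habs : ∑ i ∈ S, s i ≤ ∑ i, |s i| :=
    (Finset.sum_le_sum fun i _ => le_abs_self (s i)).trans
      (Finset.sum_le_univ_sum_of_nonneg fun i => abs_nonneg _)
  calc 1 / √(norm0 a : ℝ) * ∑ i, a i
      ≤ 1 / √(norm0 a : ℝ) * (√(norm0 a : ℝ) * √(∑ i, (s i - a i) ^ 2) + ∑ i, |s i|) := by
        gcongr
        linarith
    _ = srObj a (1 / √(norm0 a : ℝ)) s := by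
        rw [srObj, mul_add, ← mul_assoc, one_div_mul_cancel hk.ne', one_mul]

theorem sum_ite_pos_const {n : ℕ} {a : Fin n → ℝ} (hnn : ∀ i, 0 ≤ a i) (c : ℝ) :
    ∑ i, (if 0 < a i then c else 0) = norm0 a * c := by
  simp only [(hnn _).lt_iff_ne']
  rw [← Finset.sum_filter, Finset.sum_const, nsmul_eq_mul, norm0]

/-- Shifting the positive entries of `a` down by `ε` attains the value `τ ∑ aᵢ`. -/
theorem srObj_shift_eq {n : ℕ} {a : Fin n → ℝ} (hnn : ∀ i, 0 ≤ a i) (hne : a ≠ 0)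
    {ε : ℝ} (hε₀ : 0 ≤ ε) (hεmin : ∀ i, 0 < a i → ε ≤ a i) :
    srObj a (1 / √(norm0 a : ℝ)) (fun i => if 0 < a i then a i - ε else 0) =
      1 / √(norm0 a : ℝ) * ∑ i, a i := by
  have hk : 0 < √(norm0 a : ℝ) := Real.sqrt_pos.mpr (by exact_mod_cast norm0_pos hne)
  have hsq : ∑ i, ((if 0 < a i then a i - ε else 0) - a i) ^ 2 = norm0 a * ε ^ 2 := by
    rw [← sum_ite_pos_const hnn]
    refine Finset.sum_congr rfl fun i _ => ?_
    split_ifs with h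
    · ring
    · simp [le_antisymm (not_lt.mp h) (hnn i)]
  have habs : ∑ i, |if 0 < a i then a i - ε else 0| = ∑ i, a i - norm0 a * ε := by
    rw [← sum_ite_pos_const hnn, ← Finset.sum_sub_distrib]
    refine Finset.sum_congr rfl fun i _ => ?_
    split_ifs with h
    · exact abs_of_nonneg (sub_nonneg.mpr (hεmin i h))
    · simp [le_antisymm (not_lt.mp h) (hnn i)]
  rw [srObj, hsq, habs, Real.sqrt_mul (Nat.cast_nonneg _), Real.sqrt_sq hε₀]
  have hkk := Real.sq_sqrt (Nat.cast_nonneg (α := ℝ) (norm0 a))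
  field_simp
  rw [hkk]
  ring

theorem stmt_7 {n : ℕ} (a : Fin n → ℝ)
    (hsort : ∀ i j : Fin n, i ≤ j → a j ≤ a i) (hnn : ∀ i, 0 ≤ a i) (hne : a ≠ 0)
    (τ : ℝ) (hτ : τ = 1 / Real.sqrt (norm0 a))
    (ε : ℝ) (hε₀ : 0 ≤ ε) (hεmin : ∀ i, 0 < a i → ε ≤ a i) :
    ∀ s, srObj a τ (fun i => if 0 < a i then a i - ε else 0) ≤ srObj a τ s := by
  subst hτ
  intro s
  rw [srObj_shift_eq hnn hne hε₀ hεmin]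
  exact mul_sum_le_srObj hne s
end

section
/- Let n₁ ≥ n₂, ρ > 0, and let A ∈ ℝ^{n₁×n₂} be the matrix whose top n₂×n₂ block is Diag(a) and whose remaining rows are zero, where a ∈ ℝ^{n₂} satisfies a₁ ≥ a₂ ≥ ⋯ ≥ a_{n₂} ≥ 0. Then for any positive integer k, there exists an optimal solution (U*, V*) of the problem (BM_{A,ρ,k}) of the form: U* ∈ ℝ^{n₁×k} has top k×k block Diag(ξ*) and zero remaining rows, and V* ∈ ℝ^{n₂×k} has top k×k block Diag(ξ*) and zero remaining rows, for some ξ* ∈ ℝ^k with ξ*₁ ≥ ⋯ ≥ ξ*_k ≥ 0. -/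
open Matrix

/-- The Frobenius norm of a real matrix. -/
noncomputable def frob {m n : ℕ} (A : Matrix (Fin m) (Fin n) ℝ) : ℝ :=
  Real.sqrt (∑ i, ∑ j, (A i j) ^ 2)

/-- The Burer–Monteiro penalized objective
`f_pen(U,V) = ‖UVᵀ − A‖_F + (ρ/2)(‖U‖_F² + ‖V‖_F²)`. -/
noncomputable def fpen {n₁ n₂ k : ℕ} (A : Matrix (Fin n₁) (Fin n₂) ℝ) (ρ : ℝ)
    (U : Matrix (Fin n₁) (Fin k) ℝ) (V : Matrix (Fin n₂) (Fin k) ℝ) : ℝ :=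
  frob (U * Vᵀ - A) + ρ / 2 * (frob U ^ 2 + frob V ^ 2)

open Finset

/-- A real symmetric matrix is orthogonally diagonalizable with weakly decreasing eigenvalues. -/
lemma exists_orthogonal_antitone_diagonalization {n : ℕ} {S : Matrix (Fin n) (Fin n) ℝ}
    (hS : Sᵀ = S) :
    ∃ (Q : Matrix (Fin n) (Fin n) ℝ) (μ : Fin n → ℝ), Antitone μ ∧ Qᵀ * Q = 1 ∧ Q * Qᵀ = 1 ∧
      Qᵀ * S * Q = diagonal μ := by
  have hH : S.IsHermitian := by rw [IsHermitian, conjTranspose_eq_transpose_of_trivial, hS]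
  let σ := Tuple.sort (fun i => -hH.eigenvalues i)
  let P : Matrix (Fin n) (Fin n) ℝ := hH.eigenvectorUnitary
  have hP : Pᵀ * P = 1 := by
    have h := Unitary.coe_star_mul_self hH.eigenvectorUnitary
    rwa [star_eq_conjTranspose, conjTranspose_eq_transpose_of_trivial] at h
  have hd : Pᵀ * S * P = diagonal hH.eigenvalues := by
    have h := hH.conjStarAlgAut_star_eigenvectorUnitary
    rw [Unitary.conjStarAlgAut_star_apply, star_eq_conjTranspose,
      conjTranspose_eq_transpose_of_trivial] at h
    exact h
  have hQ : (P.submatrix id σ)ᵀ * P.submatrix id σ = 1 := by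
    rw [transpose_submatrix, submatrix_mul _ _ σ id σ Function.bijective_id |>.symm, hP,
      submatrix_one_equiv]
  refine ⟨P.submatrix id σ, hH.eigenvalues ∘ σ, ?_, hQ, mul_eq_one_comm.mp hQ, ?_⟩
  · intro i j hij
    have h := Tuple.monotone_sort (fun i => -hH.eigenvalues i) hij
    exact neg_le_neg_iff.mp h
  · have h : (P.submatrix id σ)ᵀ * S * P.submatrix id σ = (Pᵀ * S * P).submatrix σ σ := rfl
    rw [h, hd]
    exact submatrix_diagonal_equiv _ σ

lemma sum_sq_eq_trace_transpose_mul {m n : Type*} [Fintype m] [Fintype n] (M : Matrix m n ℝ) :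
    ∑ i, ∑ j, M i j ^ 2 = (Mᵀ * M).trace := by
  simp only [trace, diag_apply, mul_apply, transpose_apply, sq]
  exact sum_comm

lemma sum_sq_orthogonal_mul {m n : Type*} [Fintype m] [Fintype n] [DecidableEq m]
    {Q : Matrix m m ℝ} (hQ : Qᵀ * Q = 1) (M : Matrix m n ℝ) :
    ∑ i, ∑ j, (Q * M) i j ^ 2 = ∑ i, ∑ j, M i j ^ 2 := by
  rw [sum_sq_eq_trace_transpose_mul, sum_sq_eq_trace_transpose_mul, transpose_mul,
    Matrix.mul_assoc, ← Matrix.mul_assoc Qᵀ, hQ, Matrix.one_mul]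

/-- Rearrangement inequality for doubly stochastic matrices. -/
lemma Monovary.sum_doublyStochastic_le {n : Type*} [Fintype n] [DecidableEq n]
    {f g : n → ℝ} (hfg : Monovary f g) {B : Matrix n n ℝ} (hB : B ∈ doublyStochastic ℝ n) :
    ∑ i, ∑ j, f i * B i j * g j ≤ ∑ i, f i * g i := by
  obtain ⟨w, hw, hw1, rfl⟩ := exists_eq_sum_perm_of_mem_doublyStochastic hB
  calc ∑ i, ∑ j, f i * (∑ σ, w σ • σ.permMatrix ℝ) i j * g j
      = ∑ σ : Equiv.Perm n, w σ * ∑ i, f i * g (σ i) := by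
        simp only [Matrix.sum_apply, Matrix.smul_apply, smul_eq_mul, mul_sum, sum_mul]
        rw [sum_comm' (t' := univ) (s' := fun _ => univ) (by simp)]
        rw [sum_congr rfl fun j _ => sum_comm, sum_comm]
        refine sum_congr rfl fun σ _ => ?_
        rw [sum_comm]
        refine sum_congr rfl fun i _ => ?_
        simp [Equiv.toPEquiv_apply, Equiv.Perm.permMatrix, PEquiv.toMatrix_apply]
        ring
    _ ≤ ∑ σ : Equiv.Perm n, w σ * ∑ i, f i * g i :=
        sum_le_sum fun σ _ => mul_le_mul_of_nonneg_left hfg.sum_mul_comp_perm_le_sum_mul (hw σ)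
    _ = ∑ i, f i * g i := by rw [← sum_mul, hw1, one_mul]

/-- Hoffman–Wielandt inequality against a diagonal matrix. -/
lemma sum_sq_sub_le_of_diagonalization {n : ℕ} {S Q : Matrix (Fin n) (Fin n) ℝ}
    {μ a : Fin n → ℝ} (hμ : Antitone μ) (ha : Antitone a) (hQ : Qᵀ * Q = 1) (hQ' : Q * Qᵀ = 1)
    (hd : Qᵀ * S * Q = diagonal μ) :
    ∑ i, (μ i - a i) ^ 2 ≤ ∑ i, ∑ j, (S i j - diagonal a i j) ^ 2 := by
  have hS : S = Q * diagonal μ * Qᵀ := by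
    rw [← hd, ← Matrix.mul_assoc, ← Matrix.mul_assoc, hQ', Matrix.one_mul, Matrix.mul_assoc, hQ',
      Matrix.mul_one]
  have hSS : ∑ i, ∑ j, S i j ^ 2 = ∑ i, μ i ^ 2 := by
    rw [sum_sq_eq_trace_transpose_mul, hS]
    have : (Q * diagonal μ * Qᵀ)ᵀ * (Q * diagonal μ * Qᵀ)
        = Q * (diagonal μ * ((Qᵀ * Q) * diagonal μ)) * Qᵀ := by
      simp only [transpose_mul, diagonal_transpose, transpose_transpose, Matrix.mul_assoc]
    rw [this, hQ, Matrix.one_mul, trace_mul_comm, ← Matrix.mul_assoc, hQ, Matrix.one_mul,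
      diagonal_mul_diagonal, trace_diagonal]
    simp [sq]
  have hB : (of fun i j => Q j i ^ 2 : Matrix (Fin n) (Fin n) ℝ) ∈ doublyStochastic ℝ (Fin n) := by
    refine mem_doublyStochastic_iff_sum.2 ⟨fun i j => sq_nonneg _, fun i => ?_, fun j => ?_⟩
    · simpa [mul_apply, sq] using congrFun₂ hQ i i
    · simpa [mul_apply, sq] using congrFun₂ hQ' j j
  have hdiag : ∑ i, S i i * a i ≤ ∑ i, μ i * a i := by
    refine le_trans (le_of_eq ?_) ((hμ.monovary ha).sum_doublyStochastic_le hB)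
    rw [sum_comm]
    refine sum_congr rfl fun i _ => ?_
    rw [hS, mul_apply, sum_mul]
    refine sum_congr rfl fun j _ => ?_
    rw [mul_diagonal, transpose_apply, of_apply]
    ring
  have hexp : ∑ i, ∑ j, (S i j - diagonal a i j) ^ 2
      = ∑ i, ∑ j, S i j ^ 2 - 2 * ∑ i, S i i * a i + ∑ i, a i ^ 2 := by
    rw [mul_sum, ← sum_sub_distrib, ← sum_add_distrib]
    refine sum_congr rfl fun i _ => ?_
    have h : ∀ j, (S i j - diagonal a i j) ^ 2
        = S i j ^ 2 + if i = j then a i ^ 2 - 2 * (S i i * a i) else 0 := by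
      intro j
      by_cases h : i = j
      · subst h; simp; ring
      · simp [h]
    rw [sum_congr rfl fun j _ => h j, sum_add_distrib, sum_ite_eq]
    simp only [mem_univ, if_true]
    ring
  have hexp' : ∑ i, (μ i - a i) ^ 2 = ∑ i, μ i ^ 2 - 2 * ∑ i, μ i * a i + ∑ i, a i ^ 2 := by
    rw [mul_sum, ← sum_sub_distrib, ← sum_add_distrib]
    exact sum_congr rfl fun i _ => by ring
  rw [hexp, hexp', hSS]
  linarith

lemma sum_sq_symmetrization_sub_le {n : Type*} [Fintype n] [DecidableEq n] (M : Matrix n n ℝ)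
    (a : n → ℝ) :
    ∑ i, ∑ j, (((1 / 2 : ℝ) • (M + Mᵀ)) i j - diagonal a i j) ^ 2
      ≤ ∑ i, ∑ j, (M i j - diagonal a i j) ^ 2 := by
  have hswap : ∑ i, ∑ j, (M j i - diagonal a i j) ^ 2 = ∑ i, ∑ j, (M i j - diagonal a i j) ^ 2 := by
    rw [sum_comm]
    refine sum_congr rfl fun i _ => sum_congr rfl fun j _ => ?_
    rw [← transpose_apply (diagonal a), diagonal_transpose]
  have h : ∑ i, ∑ j, (((1 / 2 : ℝ) • (M + Mᵀ)) i j - diagonal a i j) ^ 2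
      ≤ ∑ i, ∑ j, ((1 / 2) * (M i j - diagonal a i j) ^ 2
        + (1 / 2) * (M j i - diagonal a i j) ^ 2) := by
    refine sum_le_sum fun i _ => sum_le_sum fun j _ => ?_
    simp only [Matrix.smul_apply, Matrix.add_apply, transpose_apply, smul_eq_mul]
    nlinarith [sq_nonneg (M i j - M j i)]
  simp only [sum_add_distrib, ← mul_sum] at h
  linarith

/-- If the symmetric part of `P * Vᵀ` is diagonal with decreasing entries, then its entries
beyond the inner dimension are nonpositive. -/
lemma nonpos_of_symmetric_part_diagonal {n k : ℕ} {P V : Matrix (Fin n) (Fin k) ℝ}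
    {μ : Fin n → ℝ} (hμ : Antitone μ) (hd : P * Vᵀ + V * Pᵀ = diagonal (fun i => 2 * μ i))
    {i : Fin n} (hi : k ≤ i) : μ i ≤ 0 := by
  by_contra! hpos
  let s : Fin (k + 1) → Fin n := fun l => ⟨l, by omega⟩
  have hs : Function.Injective s := fun l l' h => by simpa [s, Fin.ext_iff] using h
  let f := Matrix.mulVecLin ((P + V).submatrix s id)ᵀ
  have hker := f.ker_ne_bot_of_finrank_lt (by simp)
  obtain ⟨c, hc, hc0⟩ := Submodule.exists_mem_ne_zero_of_ne_bot hker
  have hsum : ∀ l, ∑ p, P (s p) l * c p = -∑ p, V (s p) l * c p := by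
    intro l
    have h := congrFun (LinearMap.mem_ker.1 hc) l
    simp only [f, mulVecLin_apply, mulVec, dotProduct, transpose_apply, submatrix_apply,
      Matrix.add_apply, add_mul, sum_add_distrib, Pi.zero_apply, id] at h
    linarith
  have hquad : ∑ p, μ (s p) * c p ^ 2
      = ∑ l, (∑ p, P (s p) l * c p) * ∑ q, V (s q) l * c q := by
    have hent : ∀ p q, ∑ l, P (s p) l * V (s q) l + ∑ l, V (s p) l * P (s q) l
        = if p = q then 2 * μ (s p) else 0 := by
      intro p q
      have h := congrFun₂ hd (s p) (s q)
      simpa [mul_apply, diagonal_apply, hs.eq_iff] using h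
    have h1 : ∑ p, ∑ q, c p * c q * ∑ l, P (s p) l * V (s q) l
        = ∑ l, (∑ p, P (s p) l * c p) * ∑ q, V (s q) l * c q := by
      simp only [sum_mul_sum]
      simp only [mul_sum]
      rw [sum_congr rfl fun p _ => sum_comm, sum_comm]
      exact sum_congr rfl fun l _ => sum_congr rfl fun p _ => sum_congr rfl fun q _ => by ring
    have h2 : ∑ p, ∑ q, c p * c q * ∑ l, V (s p) l * P (s q) l
        = ∑ p, ∑ q, c p * c q * ∑ l, P (s p) l * V (s q) l := by
      rw [sum_comm]
      refine sum_congr rfl fun p _ => sum_congr rfl fun q _ => ?_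
      rw [mul_comm (c q)]
      congr 1
      exact sum_congr rfl fun l _ => mul_comm _ _
    have h3 : ∑ p, ∑ q, c p * c q * (if p = q then 2 * μ (s p) else 0)
        = 2 * ∑ p, μ (s p) * c p ^ 2 := by
      rw [mul_sum]
      refine sum_congr rfl fun p _ => ?_
      simp
      ring
    simp only [← hent, mul_add, sum_add_distrib] at h3
    linarith
  have hle : ∑ p, μ (s p) * c p ^ 2 ≤ 0 := by
    rw [hquad]
    refine sum_nonpos fun l _ => ?_
    rw [hsum l]
    nlinarith [sq_nonneg (∑ q, V (s q) l * c q)]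
  obtain ⟨p, hp⟩ := Function.ne_iff.1 hc0
  have hμs : ∀ p, 0 < μ (s p) := fun p =>
    hpos.trans_le (hμ (Fin.le_def.2 (by simp only [s]; omega)))
  have hp' : 0 < μ (s p) * c p ^ 2 := mul_pos (hμs p) (by simpa using sq_pos_of_ne_zero hp)
  have := single_le_sum (f := fun p => μ (s p) * c p ^ 2)
    (fun p _ => mul_nonneg (hμs p).le (sq_nonneg _)) (mem_univ p)
  linarith

/-- Nonnegative decreasing vectors supported on the first `k` coordinates. -/
def sortedVectors (n k : ℕ) : Set (Fin n → ℝ) :=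
  {x | Antitone x ∧ (∀ i, 0 ≤ x i) ∧ ∀ i : Fin n, k ≤ (i : ℕ) → x i = 0}

/-- A factorization `P * Vᵀ` can be replaced by a sorted diagonal without increasing the factor
norms or the distance to a sorted nonnegative diagonal matrix. -/
lemma exists_sortedVectors_le {n k : ℕ} (P V : Matrix (Fin n) (Fin k) ℝ) {a : Fin n → ℝ}
    (ha : Antitone a) (ha0 : ∀ i, 0 ≤ a i) :
    ∃ x ∈ sortedVectors n k,
      ∑ i, x i ≤ (∑ i, ∑ j, P i j ^ 2 + ∑ i, ∑ j, V i j ^ 2) / 2 ∧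
      ∑ i, (x i - a i) ^ 2 ≤ ∑ i, ∑ j, ((P * Vᵀ) i j - diagonal a i j) ^ 2 := by
  obtain ⟨Q, μ, hμ, hQ, hQ', hd⟩ := exists_orthogonal_antitone_diagonalization
    (S := (1 / 2 : ℝ) • (P * Vᵀ + (P * Vᵀ)ᵀ))
    (by rw [transpose_smul, transpose_add, transpose_transpose, add_comm])
  have hd' : (Qᵀ * P) * (Qᵀ * V)ᵀ + (Qᵀ * V) * (Qᵀ * P)ᵀ = diagonal (fun i => 2 * μ i) := by
    have h : diagonal (fun i => 2 * μ i) = (2 : ℝ) • diagonal μ := by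
      ext i j; simp [diagonal_apply]
    rw [h, ← hd]
    simp only [transpose_mul, transpose_transpose, Matrix.mul_smul, Matrix.smul_mul, smul_smul,
      Matrix.mul_add, Matrix.add_mul, Matrix.mul_assoc]
    norm_num
  refine ⟨fun i => max (μ i) 0, ⟨fun i j hij => max_le_max_right 0 (hμ hij),
    fun i => le_max_right _ _,
    fun i hi => max_eq_right (nonpos_of_symmetric_part_diagonal hμ hd' hi)⟩, ?_, ?_⟩
  · have hQQ : Qᵀᵀ * Qᵀ = 1 := by rwa [transpose_transpose]
    rw [← sum_sq_orthogonal_mul hQQ P, ← sum_sq_orthogonal_mul hQQ V, ← sum_add_distrib, sum_div]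
    refine sum_le_sum fun i _ => ?_
    rw [← sum_add_distrib]
    refine max_le ?_ (by positivity)
    have h := congrFun₂ hd' i i
    simp only [Matrix.add_apply, mul_apply (M := Qᵀ * P), mul_apply (M := Qᵀ * V),
      transpose_apply (Qᵀ * P), transpose_apply (Qᵀ * V), diagonal_apply_eq,
      ← sum_add_distrib] at h
    have h' : 2 * μ i ≤ ∑ j, ((Qᵀ * P) i j ^ 2 + (Qᵀ * V) i j ^ 2) := by
      rw [← h]
      exact sum_le_sum fun j _ => by nlinarith [sq_nonneg ((Qᵀ * P) i j - (Qᵀ * V) i j)]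
    linarith
  · refine le_trans ?_ ((sum_sq_sub_le_of_diagonalization hμ ha hQ hQ' hd).trans
      (sum_sq_symmetrization_sub_le (P * Vᵀ) a))
    refine sum_le_sum fun i _ => ?_
    have := ha0 i
    dsimp only
    rcases le_total (μ i) 0 with h | h
    · rw [max_eq_right h]; nlinarith
    · rw [max_eq_left h]

/-- The penalized distance to `a` attains its minimum over the sorted vectors. -/
lemma exists_isMinOn_sortedVectors {n : ℕ} (k : ℕ) {ρ : ℝ} (hρ : 0 < ρ) (a : Fin n → ℝ) :
    ∃ x ∈ sortedVectors n k,
      IsMinOn (fun x : Fin n → ℝ => √(∑ i, (x i - a i) ^ 2) + ρ * ∑ i, x i)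
        (sortedVectors n k) x := by
  have hclosed : IsClosed (sortedVectors n k) := by
    have h : sortedVectors n k = (⋂ i, ⋂ j, ⋂ _ : i ≤ j, {x | x j ≤ x i}) ∩ ((⋂ i, {x | 0 ≤ x i}) ∩
        ⋂ i : Fin n, ⋂ _ : k ≤ (i : ℕ), {x | x i = 0}) := by
      ext x
      simp [sortedVectors, Antitone]
    rw [h]
    refine (isClosed_iInter fun i => isClosed_iInter fun j => isClosed_iInter fun _ =>
      isClosed_le (continuous_apply j) (continuous_apply i)).inter
      ((isClosed_iInter fun i => isClosed_le continuous_const (continuous_apply i)).inter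
      (isClosed_iInter fun i => isClosed_iInter fun _ =>
        isClosed_eq (continuous_apply i) continuous_const))
  have h0 : (0 : Fin n → ℝ) ∈ sortedVectors n k := ⟨fun _ _ _ => le_rfl, by simp, by simp⟩
  refine ContinuousOn.exists_isMinOn' (x₀ := 0) (by fun_prop) hclosed h0 ?_
  let C := √(∑ i, (0 - a i) ^ 2) / ρ
  rw [Filter.eventually_inf_principal]
  filter_upwards [(isCompact_univ_pi fun _ : Fin n => isCompact_Icc (a := (0 : ℝ))
    (b := C)).compl_mem_cocompact] with x hx hxs
  simp only [Set.mem_compl_iff, Set.mem_pi, Set.mem_univ, true_implies, not_forall, Set.mem_Icc,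
    not_and, not_le] at hx
  obtain ⟨i, hi⟩ := hx
  have hCi : C < x i := hi (hxs.2.1 i)
  have hsum : x i ≤ ∑ i, x i := single_le_sum (fun i _ => hxs.2.1 i) (mem_univ i)
  have hC : C * ρ = √(∑ i, (0 - a i) ^ 2) := div_mul_cancel₀ _ hρ.ne'
  simp only [Pi.zero_apply, sum_const_zero, mul_zero, add_zero]
  rw [← hC]
  nlinarith [Real.sqrt_nonneg (∑ i, (x i - a i) ^ 2)]

lemma frob_sq {m n : ℕ} (A : Matrix (Fin m) (Fin n) ℝ) : frob A ^ 2 = ∑ i, ∑ j, A i j ^ 2 :=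
  Real.sq_sqrt (by positivity)

lemma sum_sq_castLE_le {m n k : ℕ} (h : n ≤ m) (M : Matrix (Fin m) (Fin k) ℝ) :
    ∑ i : Fin n, ∑ j, M (Fin.castLE h i) j ^ 2 ≤ ∑ i, ∑ j, M i j ^ 2 := by
  refine (sum_map univ (Fin.castLEEmb h) (fun i => ∑ j, M i j ^ 2)).symm.trans_le ?_
  exact sum_le_sum_of_subset_of_nonneg (subset_univ _) fun _ _ _ => by positivity

lemma sum_sq_rectangular_diagonal_le {m n : ℕ} {M : Matrix (Fin m) (Fin n) ℝ} {c : Fin n → ℝ}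
    (hM : ∀ i j, M i j = if (i : ℕ) = (j : ℕ) then c j else 0) :
    ∑ i, ∑ j, M i j ^ 2 ≤ ∑ j, c j ^ 2 := by
  rw [sum_comm]
  refine sum_le_sum fun j _ => ?_
  by_cases hj : (j : ℕ) < m
  · rw [sum_eq_single ⟨j, hj⟩ (fun i _ hi => by simp [hM, Fin.ext_iff] at hi ⊢; tauto) (by simp)]
    simp [hM]
  · rw [sum_eq_zero fun i _ => ?_]
    · positivity
    · rw [hM, if_neg (by omega)]; simp

/-- Extending a nonnegative vector by zero, or truncating it, does not increase its sum. -/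
lemma sum_extend_le {n k : ℕ} {x : Fin n → ℝ} (hx : ∀ i, 0 ≤ x i) :
    ∑ l : Fin k, (if h : (l : ℕ) < n then x ⟨l, h⟩ else 0) ≤ ∑ i, x i := by
  let y : ℕ → ℝ := fun m => if h : m < n then x ⟨m, h⟩ else 0
  have hy : ∀ m, 0 ≤ y m := fun m => by
    simp only [y]
    split_ifs
    exacts [hx _, le_rfl]
  have h1 : ∑ i, x i = ∑ m ∈ range n, y m := by
    rw [sum_range]
    exact sum_congr rfl fun i _ => by simp [y]
  have h2 : ∑ m ∈ range n, y m = ∑ m ∈ range (n + k), y m :=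
    sum_subset (range_subset_range.2 (by omega)) fun m _ hm => by
      simp only [mem_range] at hm
      simp [y, hm]
  rw [h1, h2]
  refine (Fin.sum_univ_eq_sum_range y k).trans_le ?_
  exact sum_le_sum_of_subset_of_nonneg (range_subset_range.2 (by omega)) fun m _ _ => hy m

theorem stmt_14 {n₁ n₂ : ℕ} (hn : n₂ ≤ n₁) (ρ : ℝ) (hρ : 0 < ρ)
    (a : Fin n₂ → ℝ) (hsort : ∀ i j : Fin n₂, i ≤ j → a j ≤ a i) (hnn : ∀ i, 0 ≤ a i)
    (A : Matrix (Fin n₁) (Fin n₂) ℝ)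
    (hA : ∀ i j, A i j = if (i : ℕ) = (j : ℕ) then a j else 0)
    (k : ℕ) (hk : 0 < k) :
    ∃ ξ : Fin k → ℝ, (∀ i j : Fin k, i ≤ j → ξ j ≤ ξ i) ∧ (∀ i, 0 ≤ ξ i) ∧
      ∃ (Ustar : Matrix (Fin n₁) (Fin k) ℝ) (Vstar : Matrix (Fin n₂) (Fin k) ℝ),
        (∀ i j, Ustar i j = if (i : ℕ) = (j : ℕ) then ξ j else 0) ∧
        (∀ i j, Vstar i j = if (i : ℕ) = (j : ℕ) then ξ j else 0) ∧
        ∀ (U : Matrix (Fin n₁) (Fin k) ℝ) (V : Matrix (Fin n₂) (Fin k) ℝ),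
          fpen A ρ Ustar Vstar ≤ fpen A ρ U V := by
  obtain ⟨x, ⟨hx, hx0, hxk⟩, hmin⟩ := exists_isMinOn_sortedVectors k hρ a
  let ξ : Fin k → ℝ := fun l => √(if h : (l : ℕ) < n₂ then x ⟨l, h⟩ else 0)
  have hξ : ∀ l, ξ l ^ 2 = if h : (l : ℕ) < n₂ then x ⟨l, h⟩ else 0 := fun l =>
    Real.sq_sqrt (by split_ifs; exacts [hx0 _, le_rfl])
  refine ⟨ξ, fun i j hij => Real.sqrt_le_sqrt ?_, fun i => Real.sqrt_nonneg _,
    of fun i j => if (i : ℕ) = (j : ℕ) then ξ j else 0,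
    of fun i j => if (i : ℕ) = (j : ℕ) then ξ j else 0, fun _ _ => rfl, fun _ _ => rfl, ?_⟩
  · have hij' : (i : ℕ) ≤ j := hij
    split_ifs with h h' h'
    · exact hx hij'
    · omega
    · exact hx0 _
    · exact le_rfl
  intro U V
  set Us : Matrix (Fin n₁) (Fin k) ℝ := of fun i j => if (i : ℕ) = (j : ℕ) then ξ j else 0
  set Vs : Matrix (Fin n₂) (Fin k) ℝ := of fun i j => if (i : ℕ) = (j : ℕ) then ξ j else 0
  have hξsum : ∑ l, ξ l ^ 2 ≤ ∑ i, x i := by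
    simp only [hξ]
    exact sum_extend_le hx0
  have hprod : ∀ i j, (Us * Vsᵀ - A) i j = if (i : ℕ) = (j : ℕ) then x j - a j else 0 := by
    intro i j
    have h : (Us * Vsᵀ) i j = if (i : ℕ) = (j : ℕ) then x j else 0 := by
      rw [mul_apply]
      by_cases hj : (j : ℕ) < k
      · rw [sum_eq_single ⟨j, hj⟩]
        · simp only [Us, Vs, of_apply, transpose_apply, if_true]
          split_ifs with hij
          · rw [← sq, hξ]; simp
          · simp
        · intro l _ hl
          have : (j : ℕ) ≠ l := fun h => hl (Fin.ext h.symm)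
          simp [Vs, this]
        · simp
      · rw [hxk j (by omega), ite_self]
        refine sum_eq_zero fun l _ => ?_
        have : (j : ℕ) ≠ l := by omega
        simp [Vs, this]
    rw [Matrix.sub_apply, h, hA]
    split_ifs <;> simp
  have hstar : fpen A ρ Us Vs ≤ √(∑ i, (x i - a i) ^ 2) + ρ * ∑ i, x i := by
    have h1 : frob (Us * Vsᵀ - A) ≤ √(∑ i, (x i - a i) ^ 2) :=
      Real.sqrt_le_sqrt (sum_sq_rectangular_diagonal_le hprod)
    have h2 : frob Us ^ 2 ≤ ∑ i, x i := by
      rw [frob_sq]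
      exact (sum_sq_rectangular_diagonal_le fun _ _ => rfl).trans hξsum
    have h3 : frob Vs ^ 2 ≤ ∑ i, x i := by
      rw [frob_sq]
      exact (sum_sq_rectangular_diagonal_le fun _ _ => rfl).trans hξsum
    rw [fpen]
    nlinarith
  obtain ⟨z, hz, hzsum, hzdist⟩ := exists_sortedVectors_le (U.submatrix (Fin.castLE hn) id) V
    (a := a) hsort hnn
  have h1 : √(∑ i, (z i - a i) ^ 2) ≤ frob (U * Vᵀ - A) := by
    refine Real.sqrt_le_sqrt (hzdist.trans (le_trans (le_of_eq ?_) (sum_sq_castLE_le hn _)))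
    refine sum_congr rfl fun i _ => sum_congr rfl fun j _ => ?_
    rw [Matrix.sub_apply, hA, diagonal_apply]
    simp only [Fin.val_castLE, ← Fin.ext_iff]
    by_cases hij : i = j
    · subst hij; rfl
    · simp only [hij, if_false]; rfl
  have h2 : ∑ i, z i ≤ (frob U ^ 2 + frob V ^ 2) / 2 := by
    rw [frob_sq, frob_sq]
    have := sum_sq_castLE_le hn U
    simp only [submatrix_apply, id] at hzsum
    linarith
  have h3 := hmin hz
  simp only [Set.mem_ofPred_eq] at h3
  refine hstar.trans (h3.trans ?_)
  rw [fpen]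
  nlinarith
end
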